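/- Let V = {P_1,...,P_n} ⊆ F_{q^r}^m be a finite set of points and let L be an F_{q^r}-linear subspace of the polynomial ring F_{q^r}[X_1,...,X_m]. Then the trace code of the affine variety code C(V,L) equals the affine variety code of the trace of L: Tr_{F_{q^r}/F_t}(C(V,L)) = C(V, Tr_{F_{q^r}/F_t}(L)), where Tr_{F_{q^r}/F_t}(L) := {Tr applied coefficientwise-compatibly, i.e., the set of polynomials Σ_{i=0}^{m'-1} f^{(t^i)} for f ∈ L with q^r = t^{m'} and f^{(s)} denoting the polynomial obtained by raising f to the s-th power}. -/

import Mathlib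

open scoped BigOperators

/-- The affine variety code `C(V, L)`: evaluations of the polynomials of the linear
space `L` at the points `P 1, ..., P n`. -/
noncomputable def evalCode {K : Type*} [Field K] {n mv : ℕ}
    (P : Fin n → (Fin mv → K)) (L : Submodule K (MvPolynomial (Fin mv) K)) :
    Submodule K (Fin n → K) :=
  L.map (LinearMap.pi fun i => (MvPolynomial.aeval (P i)).toLinearMap)

/-- Let `K = F_{q^r}` with `q^r = t^{m'}` and let `F = F_t` be a subfield of `K`.
Let `V = {P 1, ..., P n} ⊆ K^mv` be a finite set of points and `L` a `K`-linear space of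
polynomials in `mv` variables over `K`.  Then the trace code of the affine variety code
`C(V, L)` equals the affine variety code `C(V, Tr(L))`, where
`Tr(L) = { ∑_{i=0}^{m'-1} f^{t^i} : f ∈ L }`. -/
theorem traceCode_evalCode_eq_evalCode_trace
    (q r t m' : ℕ) (hq : IsPrimePow q) (ht : IsPrimePow t) (hr : 1 < r)
    (F K : Type*) [Field F] [Field K] [Fintype F] [Fintype K] [Algebra F K]
    (hK : Fintype.card K = q ^ r) (hF : Fintype.card F = t) (hm : q ^ r = t ^ m')
    (n mv : ℕ) (P : Fin n → (Fin mv → K)) (hP : Function.Injective P)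
    (L : Submodule K (MvPolynomial (Fin mv) K)) :
    {x : Fin n → K | ∃ c ∈ evalCode P L,
        ∀ i, x i = algebraMap F K (Algebra.trace F K (c i))}
      = {x : Fin n → K | ∃ f ∈ L,
          x = fun i => MvPolynomial.eval (P i) (∑ j ∈ Finset.range m', f ^ t ^ j)} := by
  have hfin : Module.finrank F K = m' := by
    have h1 : Fintype.card K = Fintype.card F ^ Module.finrank F K :=
      Module.card_eq_pow_finrank
    rw [hK, hm, hF] at h1
    exact (Nat.pow_right_injective ht.two_le h1).symm
  have htr : ∀ y : K, algebraMap F K (Algebra.trace F K y)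
      = ∑ j ∈ Finset.range m', y ^ t ^ j := by
    intro y
    rw [FiniteField.algebraMap_trace_eq_sum_pow, hfin, Nat.card_eq_fintype_card, hF]
  ext x
  simp only [Set.mem_setOf_eq, evalCode, Submodule.mem_map, htr]
  constructor
  · rintro ⟨c, ⟨f, hf, rfl⟩, hx⟩
    refine ⟨f, hf, funext fun i => ?_⟩
    rw [hx i]
    simp [MvPolynomial.aeval_eq_eval]
  · rintro ⟨f, hf, rfl⟩
    refine ⟨_, ⟨f, hf, rfl⟩, fun i => ?_⟩
    simp [MvPolynomial.aeval_eq_eval]
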